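/- arXiv:2506.00941 — 2 statements merged into one kernel-verified Lean document; each statement's English description precedes it below -/
import Mathlib

section
/- Let σ be a permutation of [n] and let γ_σ be the acyclic orientation of the complete graph K_n that directs each edge {i,j} towards i if and only if i precedes j in the one-line notation of σ (i.e., σ^{-1}(i) < σ^{-1}(j)). Then the number of source components of γ_σ equals RLmin(σ), the number of right-to-left minima of σ. -/
open Classical

/-- The set of vertices reachable from `i` by a directed path of `γ` (including `i`). -/
noncomputable def reachSet {n : ℕ} (γ : Fin n → Fin n → Prop) (i : Fin n) : Finset (Fin n) :=
  Finset.univ.filter fun j => Relation.ReflTransGen γ i j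

/-- `scAcc γ k` is the union `S₁ ∪ ⋯ ∪ S_k` of the first `k` source components of `γ`. -/
noncomputable def scAcc {n : ℕ} (γ : Fin n → Fin n → Prop) : ℕ → Finset (Fin n)
  | 0 => ∅
  | k + 1 =>
      if h : (Finset.univ \ scAcc γ k).Nonempty then
        scAcc γ k ∪ reachSet γ ((Finset.univ \ scAcc γ k).min' h)
      else scAcc γ k

/-- `sourceComp γ k` is the `(k+1)`-st source component `S_{k+1}` of `γ`
(so the source components of the paper are `sourceComp γ 0, sourceComp γ 1, …`). -/
noncomputable def sourceComp {n : ℕ} (γ : Fin n → Fin n → Prop) (k : ℕ) : Finset (Fin n) :=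
  scAcc γ (k + 1) \ scAcc γ k

/-- The number of (nonempty) source components of `γ`. -/
noncomputable def numSourceComps {n : ℕ} (γ : Fin n → Fin n → Prop) : ℕ :=
  ((Finset.range n).filter fun k => (sourceComp γ k).Nonempty).card

theorem mem_reachSet_perm {n : ℕ} (σ : Equiv.Perm (Fin n)) (i j : Fin n) :
    j ∈ reachSet (fun a b : Fin n => a ≠ b ∧ σ.symm b < σ.symm a) i ↔
      σ.symm j ≤ σ.symm i := by
  simp only [reachSet, Finset.mem_filter, Finset.mem_univ, true_and]
  constructor
  · intro h
    induction h with
    | refl => exact le_rfl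
    | tail _ hbc ih => exact hbc.2.le.trans ih
  · intro h
    rcases h.eq_or_lt with h | h
    · rw [σ.symm.injective h]
    · exact Relation.ReflTransGen.single ⟨fun e => h.ne (by rw [e]), h⟩

theorem scAcc_succ_of_nonempty {n : ℕ} (γ : Fin n → Fin n → Prop) (k : ℕ)
    (h : (Finset.univ \ scAcc γ k).Nonempty) :
    scAcc γ (k + 1) = scAcc γ k ∪ reachSet γ ((Finset.univ \ scAcc γ k).min' h) := by
  simp only [scAcc, dif_pos h]

theorem scAcc_succ_of_not_nonempty {n : ℕ} (γ : Fin n → Fin n → Prop) (k : ℕ)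
    (h : ¬ (Finset.univ \ scAcc γ k).Nonempty) : scAcc γ (k + 1) = scAcc γ k := by
  simp only [scAcc, dif_neg h]

theorem self_mem_reachSet {n : ℕ} (γ : Fin n → Fin n → Prop) (i : Fin n) :
    i ∈ reachSet γ i := by
  simp [reachSet, Relation.ReflTransGen.refl]

theorem min_compl_mem_sourceComp {n : ℕ} (γ : Fin n → Fin n → Prop) (k : ℕ)
    (h : (Finset.univ \ scAcc γ k).Nonempty) :
    (Finset.univ \ scAcc γ k).min' h ∈ sourceComp γ k := by
  rw [sourceComp, scAcc_succ_of_nonempty γ k h]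
  exact Finset.mem_sdiff.2 ⟨Finset.mem_union_right _ (self_mem_reachSet γ _),
    (Finset.mem_sdiff.1 (Finset.min'_mem _ h)).2⟩

/-- As long as vertices remain, each source component contributes at least one new vertex. -/
theorem scAcc_eq_univ_or_le_card {n : ℕ} (γ : Fin n → Fin n → Prop) (k : ℕ) :
    scAcc γ k = Finset.univ ∨ k ≤ (scAcc γ k).card := by
  induction k with
  | zero => exact Or.inr (Nat.zero_le _)
  | succ k ih =>
    by_cases h : (Finset.univ \ scAcc γ k).Nonempty
    · have hne : scAcc γ k ≠ Finset.univ := fun e => by simp [e] at h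
      have hm := Finset.mem_sdiff.1 (min_compl_mem_sourceComp γ k h)
      have hsub : scAcc γ k ⊆ scAcc γ (k + 1) := by
        rw [scAcc_succ_of_nonempty γ k h]
        exact Finset.subset_union_left
      exact Or.inr ((ih.resolve_left hne).trans_lt
        (Finset.card_lt_card ((Finset.ssubset_iff_of_subset hsub).2 ⟨_, hm⟩)))
    · left
      rw [scAcc_succ_of_not_nonempty γ k h]
      simpa [Finset.sdiff_eq_empty_iff_subset, Finset.univ_subset_iff] using h

theorem scAcc_eq_univ {n : ℕ} (γ : Fin n → Fin n → Prop) : scAcc γ n = Finset.univ := by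
  rcases scAcc_eq_univ_or_le_card γ n with h | h
  · exact h
  · exact (Finset.card_eq_iff_eq_univ _).1
      (le_antisymm (Finset.card_le_univ _) (by simpa using h))

/-- The vertices covered so far form an initial segment of the one-line notation. -/
theorem scAcc_perm_of_le {n : ℕ} (σ : Equiv.Perm (Fin n)) (k : ℕ) {i j : Fin n}
    (hij : i ≤ j)
    (hj : σ j ∈ scAcc (fun a b : Fin n => a ≠ b ∧ σ.symm b < σ.symm a) k) :
    σ i ∈ scAcc (fun a b : Fin n => a ≠ b ∧ σ.symm b < σ.symm a) k := by
  induction k with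
  | zero => simp [scAcc] at hj
  | succ k ih =>
    by_cases h : (Finset.univ \
        scAcc (fun a b : Fin n => a ≠ b ∧ σ.symm b < σ.symm a) k).Nonempty
    · rw [scAcc_succ_of_nonempty _ k h, Finset.mem_union, mem_reachSet_perm,
        Equiv.symm_apply_apply] at hj ⊢
      exact hj.imp ih hij.trans
    · rw [scAcc_succ_of_not_nonempty _ k h] at hj ⊢
      exact ih hj

/-- The nonempty components among the first `k` correspond to the right-to-left minima
they cover. -/
theorem card_nonempty_sourceComp_eq {n : ℕ} (σ : Equiv.Perm (Fin n)) (k : ℕ) :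
    ((Finset.range k).filter fun l =>
        (sourceComp (fun a b : Fin n => a ≠ b ∧ σ.symm b < σ.symm a) l).Nonempty).card =
      (Finset.univ.filter fun i : Fin n => (∀ j : Fin n, i < j → σ i < σ j) ∧
        σ i ∈ scAcc (fun a b : Fin n => a ≠ b ∧ σ.symm b < σ.symm a) k).card := by
  induction k with
  | zero => simp [scAcc]
  | succ k ih =>
    have hdown := @scAcc_perm_of_le n σ k
    have hreach := mem_reachSet_perm σ
    generalize (fun a b : Fin n => a ≠ b ∧ σ.symm b < σ.symm a) = γ at *
    rw [Finset.range_add_one, Finset.filter_insert]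
    by_cases h : (Finset.univ \ scAcc γ k).Nonempty
    · rw [if_pos ⟨_, min_compl_mem_sourceComp γ k h⟩,
        Finset.card_insert_of_notMem (by simp), ih, scAcc_succ_of_nonempty γ k h]
      have hm := (Finset.mem_sdiff.1 (Finset.min'_mem _ h)).2
      have hmin : ∀ x, x ∉ scAcc γ k → (Finset.univ \ scAcc γ k).min' h ≤ x := fun x hx =>
        Finset.min'_le _ _ (by simpa using hx)
      generalize (Finset.univ \ scAcc γ k).min' h = m at *
      obtain ⟨p, rfl⟩ := σ.surjective m
      rw [← Finset.card_insert_of_notMem (a := p) (by simp [hm])]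
      congr 1
      ext q
      simp only [Finset.mem_insert, Finset.mem_filter, Finset.mem_univ, true_and,
        Finset.mem_union, hreach, Equiv.symm_apply_apply]
      constructor
      · rintro (rfl | ⟨hq, hqk⟩)
        · refine ⟨fun j hj => ?_, Or.inr le_rfl⟩
          exact lt_of_le_of_ne (hmin _ fun hjk => hm (hdown hj.le hjk))
            (σ.injective.ne hj.ne)
        · exact ⟨hq, Or.inl hqk⟩
      · rintro ⟨hq, hqk⟩
        by_cases hc : σ q ∈ scAcc γ k
        · exact Or.inr ⟨hq, hc⟩
        · rcases (hqk.resolve_left hc).eq_or_lt with e | hlt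
          · exact Or.inl e
          · exact absurd (hq p hlt) (hmin _ hc).not_gt
    · rw [if_neg (by simp [sourceComp, scAcc_succ_of_not_nonempty γ k h]),
        scAcc_succ_of_not_nonempty γ k h, ih]

/-- the number of source components of the acyclic orientation of `Kₙ`
associated to a permutation `σ` (each edge directed towards the earlier entry in the
one-line notation of `σ`) equals the number of right-to-left minima of `σ`. -/
theorem sourceComps_eq_RLmin {n : ℕ} (σ : Equiv.Perm (Fin n)) :
    numSourceComps (fun a b : Fin n => a ≠ b ∧ σ.symm b < σ.symm a) =
      (Finset.univ.filter fun i : Fin n => ∀ j : Fin n, i < j → σ i < σ j).card := by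
  rw [numSourceComps, card_nonempty_sourceComp_eq, scAcc_eq_univ]
  simp only [Finset.mem_univ, and_true]
end

section
/- Let σ be a permutation of [n] and let γ_σ be the acyclic orientation of the complete graph K_n that directs each edge {i,j} towards i if and only if i precedes j in the one-line notation of σ. Then an element i ∈ [n] is a right-to-left minimum of σ (i.e., every element appearing after i in the one-line notation of σ is greater than i) if and only if i is the least element of the source component of γ_σ containing i. -/
open Classical

theorem mem_sourceComp {n : ℕ} {γ : Fin n → Fin n → Prop} {k : ℕ} {i : Fin n} :
    i ∈ sourceComp γ k ↔
      i ∉ scAcc γ k ∧ ∃ m, IsLeast {x | x ∉ scAcc γ k} m ∧ Relation.ReflTransGen γ m i := by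
  rw [sourceComp, Finset.mem_sdiff, and_comm]
  refine and_congr_right fun hi => ?_
  have h : (Finset.univ \ scAcc γ k).Nonempty := ⟨i, by simpa using hi⟩
  have hm : IsLeast {x | x ∉ scAcc γ k} ((Finset.univ \ scAcc γ k).min' h) :=
    ⟨by simpa using Finset.min'_mem _ h, fun x hx => Finset.min'_le _ x (by simpa using hx)⟩
  simp only [scAcc, dif_pos h, Finset.mem_union, hi, false_or, reachSet, Finset.mem_filter,
    Finset.mem_univ, true_and]
  exact ⟨fun hr => ⟨_, hm, hr⟩, fun ⟨_, hm', hr⟩ => hm.unique hm' ▸ hr⟩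

theorem mem_scAcc_succ {n : ℕ} {γ : Fin n → Fin n → Prop} {k : ℕ} {i : Fin n} :
    i ∈ scAcc γ (k + 1) ↔ i ∈ scAcc γ k ∨ i ∈ sourceComp γ k := by
  have hsub : scAcc γ k ⊆ scAcc γ (k + 1) := by
    rw [scAcc]
    split_ifs
    · exact Finset.subset_union_left
    · exact subset_rfl
  rw [sourceComp, Finset.mem_sdiff]
  have := @hsub i
  tauto

theorem mem_scAcc_of_reflTransGen {n : ℕ} {γ : Fin n → Fin n → Prop} {i j : Fin n}
    (hij : Relation.ReflTransGen γ i j) (k : ℕ) (hi : i ∈ scAcc γ k) : j ∈ scAcc γ k := by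
  induction k with
  | zero => simp [scAcc] at hi
  | succ k ih =>
    rw [mem_scAcc_succ] at hi ⊢
    by_cases hj : j ∈ scAcc γ k
    · exact .inl hj
    · obtain ⟨_, m, hm, hr⟩ := mem_sourceComp.1 (hi.resolve_left fun h => hj (ih h))
      exact .inr (mem_sourceComp.2 ⟨hj, m, hm, hr.trans hij⟩)

theorem mem_scAcc_of_lt {n : ℕ} (γ : Fin n → Fin n → Prop) (k : ℕ) (i : Fin n)
    (hi : (i : ℕ) < k) : i ∈ scAcc γ k := by
  induction k generalizing i with
  | zero => omega
  | succ k ih =>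
    rw [mem_scAcc_succ]
    by_cases h : i ∈ scAcc γ k
    · exact .inl h
    · refine .inr (mem_sourceComp.2 ⟨h, i, ⟨h, fun x hx => ?_⟩, .refl⟩)
      have : ¬ (x : ℕ) < k := fun hxk => hx (ih x hxk)
      exact Fin.le_def.2 (by omega)

theorem exists_mem_sourceComp {n : ℕ} (γ : Fin n → Fin n → Prop) (i : Fin n) :
    ∃ k, i ∈ sourceComp γ k := by
  by_contra! h
  have hnot : ∀ k, i ∉ scAcc γ k := fun k => by
    induction k with
    | zero => simp [scAcc]
    | succ k ih => exact fun hi => (mem_scAcc_succ.1 hi).elim ih (h k)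
  exact hnot (i + 1) (mem_scAcc_of_lt γ _ i (Nat.lt_succ_self _))

theorem symm_le_of_reflTransGen {n : ℕ} (σ : Equiv.Perm (Fin n)) {i j : Fin n}
    (h : Relation.ReflTransGen (fun a b : Fin n => a ≠ b ∧ σ.symm b < σ.symm a) i j) :
    σ.symm j ≤ σ.symm i := by
  induction h with
  | refl => exact le_rfl
  | tail _ h ih => exact h.2.le.trans ih

/-- `i` is a right-to-left minimum of `σ` (every element appearing after `i`
in the one-line notation of `σ` is greater than `i`) iff `i` is the least element of the
source component (of the orientation of `Kₙ` associated to `σ`) containing it. -/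
theorem RLmin_iff_least_in_sourceComp {n : ℕ} (σ : Equiv.Perm (Fin n)) (i : Fin n) :
    (∀ j : Fin n, σ.symm i < σ.symm j → i < j) ↔
      (∀ k : ℕ, i ∈ sourceComp (fun a b : Fin n => a ≠ b ∧ σ.symm b < σ.symm a) k →
        ∀ j ∈ sourceComp (fun a b : Fin n => a ≠ b ∧ σ.symm b < σ.symm a) k, i ≤ j) := by
  constructor
  · intro h k hi j hj
    obtain ⟨hik, m, hm, hr⟩ := mem_sourceComp.1 hi
    have him : i ≤ m := by
      rcases (symm_le_of_reflTransGen σ hr).eq_or_lt with he | hlt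
      · exact (σ.symm.injective he).le
      · exact (h m hlt).le
    exact him.trans (hm.2 (mem_sourceComp.1 hj).1)
  · intro h j hij
    obtain ⟨k, hk⟩ := exists_mem_sourceComp (fun a b : Fin n => a ≠ b ∧ σ.symm b < σ.symm a) i
    obtain ⟨hik, m, hm, -⟩ := mem_sourceComp.1 hk
    have him : i ≤ m := h k hk m (mem_sourceComp.2 ⟨hm.1, m, hm, .refl⟩)
    have hne : j ≠ i := fun he => (he ▸ hij).false
    have hj : j ∉ scAcc (fun a b : Fin n => a ≠ b ∧ σ.symm b < σ.symm a) k :=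
      fun hj => hik (mem_scAcc_of_reflTransGen (.single ⟨hne, hij⟩) k hj)
    exact lt_of_le_of_ne (him.trans (hm.2 hj)) hne.symm
end
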